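/- Let m, n, d ≥ 1 be integers with m > n, and set β = ⌊nd/(m−n)⌋ and t = nd mod (m−n). Let G_ℓp denote the block-diagonal pencil (direct sum) consisting of t copies of L_{β+1}ᵀ and m−n−t copies of L_βᵀ, a pencil of size (m+n(d−1)) × nd. Then the set {P ∈ POL_{d,m×n} : C¹_P is strictly equivalent to G_ℓp} is dense in POL_{d,m×n}; that is, its closure in the metric space POL_{d,m×n} equals all of POL_{d,m×n}. -/

import Mathlib

open Matrix Finset

namespace MPoly

/-- The space `POL_{d,m×n}` of `m × n` complex matrix polynomials of grade `d`,
identified with the tuple of coefficients `(A_0, …, A_d)`. -/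
abbrev Pol (d m n : ℕ) := Fin (d+1) → Matrix (Fin m) (Fin n) ℂ

/-- A matrix pencil `λ A + B` of size `p × q`, identified with the pair `(A, B)`. -/
abbrev Pencil (p q : ℕ) := Matrix (Fin p) (Fin q) ℂ × Matrix (Fin p) (Fin q) ℂ

/-- The metric on `POL_{d,m×n}`:  `dist(P,P') = (Σ_i ‖A_i − A'_i‖_F²)^(1/2)`. -/
noncomputable def polDist {m n d : ℕ} (P P' : Pol d m n) : ℝ :=
  Real.sqrt (∑ k, ∑ i, ∑ j, ‖P k i j - P' k i j‖ ^ 2)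

/-- The Frobenius norm of a matrix polynomial: `‖P‖_F = (Σ_i ‖A_i‖_F²)^(1/2)`. -/
noncomputable def polNorm {m n d : ℕ} (P : Pol d m n) : ℝ :=
  Real.sqrt (∑ k, ∑ i, ∑ j, ‖P k i j‖ ^ 2)

/-- The metric on pencils: `dist(λA+B, λA'+B') = (‖A−A'‖_F² + ‖B−B'‖_F²)^(1/2)`. -/
noncomputable def penDist {p q : ℕ} (L L' : Pencil p q) : ℝ :=
  Real.sqrt ((∑ i, ∑ j, ‖L.1 i j - L'.1 i j‖ ^ 2) + (∑ i, ∑ j, ‖L.2 i j - L'.2 i j‖ ^ 2))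

/-- The `λ`-part `A = diag(A_d, I_n, …, I_n)` of the first companion form. -/
noncomputable def compA (m n d : ℕ) (P : Pol d m n) :
    Matrix (Fin (m + n*(d-1))) (Fin (n*d)) ℂ := fun i j =>
  if hi : (i : ℕ) < m then
    if hj : (j : ℕ) < n then P (Fin.last d) ⟨i, hi⟩ ⟨j, hj⟩ else 0
  else if (i : ℕ) - m = (j : ℕ) - n ∧ n ≤ (j : ℕ) then 1 else 0

/-- The constant part `B` of the first companion form: first block row
`(A_{d-1}, …, A_0)`, with `−I_n` in block entries `(i+1, i)`. -/
noncomputable def compB (m n d : ℕ) (P : Pol d m n) :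
    Matrix (Fin (m + n*(d-1))) (Fin (n*d)) ℂ := fun i j =>
  if hi : (i : ℕ) < m then
    if hn : 0 < n then
      P ⟨d - 1 - (j : ℕ) / n, Nat.lt_succ_of_le ((Nat.sub_le _ _).trans (Nat.sub_le d 1))⟩ ⟨i, hi⟩ ⟨(j : ℕ) % n, Nat.mod_lt _ hn⟩
    else 0
  else if (j : ℕ) = (i : ℕ) - m then -1 else 0

/-- The first Frobenius companion form `C¹_P` of a matrix polynomial. -/
noncomputable def comp (m n d : ℕ) (P : Pol d m n) : Pencil (m + n*(d-1)) (n*d) :=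
  (compA m n d P, compB m n d P)

/-- Strict equivalence of matrix pencils: `Q⁻¹ (λA+B) R = λC+D` for invertible `Q, R`. -/
def StrictEquiv {p q : ℕ} (L M : Pencil p q) : Prop :=
  ∃ (Q : Matrix (Fin p) (Fin p) ℂ) (R : Matrix (Fin q) (Fin q) ℂ),
    IsUnit Q ∧ IsUnit R ∧ Q⁻¹ * L.1 * R = M.1 ∧ Q⁻¹ * L.2 * R = M.2

/-- The strict equivalence orbit of a pencil. -/
def orbE {p q : ℕ} (L : Pencil p q) : Set (Pencil p q) := {M | StrictEquiv L M}

/-- The generalized Sylvester space `GSYL¹_{d,m×n}` of all first companion forms. -/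
def GSYL (m n d : ℕ) : Set (Pencil (m + n*(d-1)) (n*d)) := Set.range (comp m n d)

/-- A matrix polynomial viewed as a matrix over the field `ℂ(λ)` of rational functions. -/
noncomputable def ratMatrix {m n d : ℕ} (P : Pol d m n) :
    Matrix (Fin m) (Fin n) (RatFunc ℂ) :=
  fun i j => ∑ k : Fin (d+1), RatFunc.C (P k i j) * RatFunc.X ^ (k : ℕ)

/-- The normal rank of a matrix polynomial: its rank over `ℂ(λ)`. -/
noncomputable def nrank {m n d : ℕ} (P : Pol d m n) : ℕ := (ratMatrix P).rank

/-- Offset of the `b`-th diagonal block when block `j` has size `sz j`. -/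
def off (sz : ℕ → ℕ) (b : ℕ) : ℕ := ∑ j ∈ Finset.range b, sz j

/-- The `p × q` matrix given as a direct sum of `N` diagonal blocks, where block `b`
has size `ρ b × γ b` and entries `ent b`, blocks being laid out along the diagonal
in order (block `b` occupies rows `[off ρ b, off ρ b + ρ b)` and columns
`[off γ b, off γ b + γ b)`); all other entries are zero. -/
noncomputable def dsum (N : ℕ) (ρ γ : ℕ → ℕ) (ent : ℕ → ℕ → ℕ → ℂ) (p q : ℕ) :
    Matrix (Fin p) (Fin q) ℂ := fun x y =>
  ∑ b ∈ Finset.range N,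
    if off ρ b ≤ (x:ℕ) ∧ (x:ℕ) < off ρ b + ρ b ∧ off γ b ≤ (y:ℕ) ∧ (y:ℕ) < off γ b + γ b
    then ent b ((x:ℕ) - off ρ b) ((y:ℕ) - off γ b) else 0

/-- Sizes of the four sections of blocks: `c₁` blocks of size `v₁`, then `c₂` of size
`v₂`, then `c₃` of size `v₃`, then the rest of size `v₄`. -/
def secSize (c₁ c₂ c₃ : ℕ) (v₁ v₂ v₃ v₄ : ℕ) (i : ℕ) : ℕ :=
  if i < c₁ then v₁ else if i < c₁ + c₂ then v₂ else if i < c₁ + c₂ + c₃ then v₃ else v₄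

/-- The `p × q` pencil which is the direct sum of `c₁` copies of `L_{e₁}`, `c₂` copies
of `L_{e₂}`, `c₃` copies of `L_{f₁}ᵀ` and `c₄` copies of `L_{f₂}ᵀ`.  Here `L_k` is the
`k × (k+1)` pencil `λ G_k + F_k` with `G_k` having ones in entries `(i,i)` and `F_k`
having ones in entries `(i,i+1)`. -/
noncomputable def genPencil (c₁ c₂ c₃ c₄ e₁ e₂ f₁ f₂ p q : ℕ) : Pencil p q :=
  (dsum (c₁+c₂+c₃+c₄) (secSize c₁ c₂ c₃ e₁ e₂ (f₁+1) (f₂+1))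
     (secSize c₁ c₂ c₃ (e₁+1) (e₂+1) f₁ f₂)
     (fun _ i j => if i = j then 1 else 0) p q,
   dsum (c₁+c₂+c₃+c₄) (secSize c₁ c₂ c₃ e₁ e₂ (f₁+1) (f₂+1))
     (secSize c₁ c₂ c₃ (e₁+1) (e₂+1) f₁ f₂)
     (fun b i j => if b < c₁ + c₂ then (if j = i+1 then 1 else 0)
       else (if i = j+1 then 1 else 0)) p q)

/-- The generic pencil `G_a` of Theorem 3.2 (viewed at grade `d`):  the direct sum of
`s` copies of `L_{α+d}`, `n−r−s` copies of `L_{α+d−1}`, `t` copies of `L_{β+1}ᵀ` and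
`m−r−t` copies of `L_βᵀ`, where `α = ⌊a/(n−r)⌋`, `s = a mod (n−r)`,
`β = ⌊(rd−a)/(m−r)⌋`, `t = (rd−a) mod (m−r)`. -/
noncomputable def Ga (m n d r a : ℕ) : Pencil (m + n*(d-1)) (n*d) :=
  genPencil (a % (n-r)) (n-r - a % (n-r)) ((r*d - a) % (m-r)) (m-r - (r*d - a) % (m-r))
    (a/(n-r) + d) (a/(n-r) + d - 1) ((r*d - a)/(m-r) + 1) ((r*d - a)/(m-r))
    (m + n*(d-1)) (n*d)


/-- The generic rank-`ρ` pencil of size `p × q` with parameter `b` (Theorem 3.2 of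
De Terán–Dopico): direct sum of `s₁` copies of `L_{α₁+1}`, `q−ρ−s₁` copies of `L_{α₁}`,
`t₁` copies of `L_{β₁+1}ᵀ` and `p−ρ−t₁` copies of `L_{β₁}ᵀ`, where `α₁ = ⌊b/(q−ρ)⌋`,
`s₁ = b mod (q−ρ)`, `β₁ = ⌊(ρ−b)/(p−ρ)⌋`, `t₁ = (ρ−b) mod (p−ρ)`. -/
noncomputable def Kp (p q ρ b : ℕ) : Pencil p q :=
  genPencil (b % (q-ρ)) (q-ρ - b % (q-ρ)) ((ρ-b) % (p-ρ)) (p-ρ - (ρ-b) % (p-ρ))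
    (b/(q-ρ) + 1) (b/(q-ρ)) ((ρ-b)/(p-ρ) + 1) ((ρ-b)/(p-ρ)) p q

/-- The generic right-singular pencil `G_rp` (case `m < n`): direct sum of `s` copies of
`L_{α+d}` and `n−m−s` copies of `L_{α+d−1}`, with `α = ⌊md/(n−m)⌋`, `s = md mod (n−m)`. -/
noncomputable def Grp (m n d : ℕ) : Pencil (m + n*(d-1)) (n*d) :=
  genPencil (m*d % (n-m)) (n-m - m*d % (n-m)) 0 0
    (m*d/(n-m) + d) (m*d/(n-m) + d - 1) 0 0 (m + n*(d-1)) (n*d)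

/-- The generic left-singular pencil `G_ℓp` (case `m > n`): direct sum of `t` copies of
`L_{β+1}ᵀ` and `m−n−t` copies of `L_βᵀ`, with `β = ⌊nd/(m−n)⌋`, `t = nd mod (m−n)`. -/
noncomputable def Glp (m n d : ℕ) : Pencil (m + n*(d-1)) (n*d) :=
  genPencil 0 0 (n*d % (m-n)) (m-n - n*d % (m-n)) 0 0
    (n*d/(m-n) + 1) (n*d/(m-n)) (m + n*(d-1)) (n*d)

/-- The linear map `(X, Y) ↦ (XA − AY, XB − BY)` whose range is the tangent space at
`λA+B` to the strict equivalence orbit of the pencil `λA+B`. -/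
noncomputable def tangentMap {p q : ℕ} (L : Pencil p q) :
    (Matrix (Fin p) (Fin p) ℂ × Matrix (Fin q) (Fin q) ℂ) →ₗ[ℂ]
      (Matrix (Fin p) (Fin q) ℂ × Matrix (Fin p) (Fin q) ℂ) where
  toFun XY := (XY.1 * L.1 - L.1 * XY.2, XY.1 * L.2 - L.2 * XY.2)
  map_add' X Y := by
    obtain ⟨X₁, X₂⟩ := X; obtain ⟨Y₁, Y₂⟩ := Y
    simp only [Prod.mk_add_mk, Matrix.add_mul, Matrix.mul_add, Prod.mk.injEq]
    constructor <;> abel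
  map_smul' c X := by
    obtain ⟨X₁, X₂⟩ := X
    simp only [Prod.smul_mk, Matrix.smul_mul, Matrix.mul_smul, RingHom.id_apply,
      Prod.mk.injEq, smul_sub]

/-- The tangent space `T = {(XA − AY, XB − BY)}` at `λA+B` to its strict equivalence
orbit, as a subspace of the pencil space. -/
noncomputable def tangent {p q : ℕ} (L : Pencil p q) :
    Submodule ℂ (Matrix (Fin p) (Fin q) ℂ × Matrix (Fin p) (Fin q) ℂ) :=
  LinearMap.range (tangentMap L)

/-- The first companion form `C¹_M(λ) = λ A + B` regarded as a matrix over `ℂ[λ]`. -/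
noncomputable def compPoly (m n d : ℕ) (M : Pol d m n) :
    Matrix (Fin (m + n*(d-1))) (Fin (n*d)) (Polynomial ℂ) := fun i j =>
  Polynomial.C (compA m n d M i j) * Polynomial.X + Polynomial.C (compB m n d M i j)

/-- The block-diagonal matrix `diag(M(λ), I_{n(d−1)})` over `ℂ[λ]`. -/
noncomputable def polyBlock (m n d : ℕ) (M : Pol d m n) :
    Matrix (Fin (m + n*(d-1))) (Fin (n*d)) (Polynomial ℂ) := fun i j =>
  if hi : (i : ℕ) < m then
    if hj : (j : ℕ) < n then
      ∑ k : Fin (d+1), Polynomial.C (M k ⟨i, hi⟩ ⟨j, hj⟩) * Polynomial.X ^ (k : ℕ)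
    else 0
  else if (i : ℕ) - m = (j : ℕ) - n ∧ n ≤ (j : ℕ) then 1 else 0

/-- The first companion form regarded as a matrix over the field `ℂ(λ)`. -/
noncomputable def compRat (m n d : ℕ) (M : Pol d m n) :
    Matrix (Fin (m + n*(d-1))) (Fin (n*d)) (RatFunc ℂ) := fun i j =>
  RatFunc.C (compA m n d M i j) * RatFunc.X + RatFunc.C (compB m n d M i j)


theorem ext_ker {V W : Type*} [AddCommGroup V] [Module ℂ V] [AddCommGroup W] [Module ℂ W]
    [FiniteDimensional ℂ W] (Ψ0 Ψ1 : V →ₗ[ℂ] W)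
    (h : Function.Surjective (Ψ0 + Ψ1)) (x0 : V) (hx0 : (Ψ0 + Ψ1) x0 = 0) :
    ∃ x : ℂ → V, x 1 = x0 ∧ (∀ s : ℂ, (Ψ0 + s • Ψ1) (x s) = 0) ∧
      ∀ φ : V →ₗ[ℂ] ℂ, ∃ f : Polynomial ℂ, ∀ s, φ (x s) = f.eval s := by
  obtain ⟨N, hN⟩ := (Ψ0 + Ψ1).exists_rightInverse_of_surjective (LinearMap.range_eq_top.2 h)
  let b := Module.finBasis ℂ W
  let T : ℂ → Matrix (Fin (Module.finrank ℂ W)) (Fin (Module.finrank ℂ W)) ℂ :=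
    fun s => LinearMap.toMatrix b b ((Ψ0 + s • Ψ1) ∘ₗ N)
  let M : Matrix (Fin (Module.finrank ℂ W)) (Fin (Module.finrank ℂ W)) (Polynomial ℂ) :=
    fun i j => Polynomial.C (LinearMap.toMatrix b b (Ψ0 ∘ₗ N) i j) +
      Polynomial.X * Polynomial.C (LinearMap.toMatrix b b (Ψ1 ∘ₗ N) i j)
  have hM : ∀ s, (Polynomial.evalRingHom s).mapMatrix M = T s := by
    intro s
    ext i j
    change Polynomial.eval s (M i j) = _
    simp [M, T, LinearMap.add_comp, LinearMap.smul_comp]; ring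
  have hdet : ∀ s, (T s).det = (M.det).eval s := by
    intro s
    rw [← hM s, ← RingHom.map_det]; rfl
  have hadj : ∀ s i j, (T s).adjugate i j = (M.adjugate i j).eval s := by
    intro s i j
    rw [← hM s, ← RingHom.map_adjugate]; rfl
  refine ⟨fun s => (T s).det • x0 - N (Matrix.toLin b b (T s).adjugate ((Ψ0 + s • Ψ1) x0)),
    ?_, ?_, ?_⟩
  · have h1 : T 1 = 1 := by
      simp only [T, one_smul, hN]
      exact LinearMap.toMatrix_id b
    simp only [one_smul, hx0, map_zero, h1, Matrix.det_one, sub_zero]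
  · intro s
    have hT : (Ψ0 + s • Ψ1) ∘ₗ N = Matrix.toLin b b (T s) := by
      simp only [T, Matrix.toLin_toMatrix]
    have h2 : ∀ w, (Ψ0 + s • Ψ1) (N (Matrix.toLin b b (T s).adjugate w)) = (T s).det • w := by
      intro w
      have : (Ψ0 + s • Ψ1) (N (Matrix.toLin b b (T s).adjugate w)) =
        ((Ψ0 + s • Ψ1) ∘ₗ N) (Matrix.toLin b b (T s).adjugate w) := rfl
      rw [this, hT, ← LinearMap.comp_apply, ← Matrix.toLin_mul, Matrix.mul_adjugate, map_smul,
        Matrix.toLin_one]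
      rfl
    rw [map_sub, h2, map_smul, sub_self]
  · intro φ
    refine ⟨M.det * Polynomial.C (φ x0) - ∑ j, (∑ i, M.adjugate j i *
      (Polynomial.C (b.repr (Ψ0 x0) i) + Polynomial.X * Polynomial.C (b.repr (Ψ1 x0) i))) *
        Polynomial.C (φ (N (b j))), ?_⟩
    intro s
    simp only [map_sub, map_smul, Matrix.toLin_apply, map_sum, Matrix.mulVec, dotProduct,
      hdet, hadj, smul_eq_mul, LinearMap.add_apply, LinearMap.smul_apply, map_add,
      Polynomial.eval_sub, Polynomial.eval_mul, Polynomial.eval_add, Polynomial.eval_finsetSum,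
      Polynomial.eval_C, Polynomial.eval_X]
    congr 1
    rw [Finset.mul_sum, ← Finset.sum_add_distrib]
    refine Finset.sum_congr rfl fun j _ => ?_
    rw [← mul_assoc, ← add_mul, Finset.mul_sum, ← Finset.sum_add_distrib]
    congr 1
    refine Finset.sum_congr rfl fun i _ => ?_
    ring

/-- The linear map `(Q, R) ↦ (A R − Q A', B R − Q B')`. -/
noncomputable def interMap {p q : ℕ} (L G : Pencil p q) :
    (Matrix (Fin p) (Fin p) ℂ × Matrix (Fin q) (Fin q) ℂ) →ₗ[ℂ]
      (Matrix (Fin p) (Fin q) ℂ × Matrix (Fin p) (Fin q) ℂ) where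
  toFun XY := (L.1 * XY.2 - XY.1 * G.1, L.2 * XY.2 - XY.1 * G.2)
  map_add' X Y := by
    obtain ⟨X₁, X₂⟩ := X; obtain ⟨Y₁, Y₂⟩ := Y
    simp only [Prod.mk_add_mk, Matrix.add_mul, Matrix.mul_add, Prod.mk.injEq]
    constructor <;> abel
  map_smul' c X := by
    obtain ⟨X₁, X₂⟩ := X
    simp only [Prod.smul_mk, Matrix.smul_mul, Matrix.mul_smul, RingHom.id_apply,
      Prod.mk.injEq, smul_sub]

theorem det_poly {N : ℕ} (Q : ℂ → Matrix (Fin N) (Fin N) ℂ)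
    (h : ∀ i j, ∃ f : Polynomial ℂ, ∀ s, Q s i j = f.eval s) :
    ∃ f : Polynomial ℂ, ∀ s, (Q s).det = f.eval s := by
  choose F hF using h
  refine ⟨(Matrix.of F).det, fun s => ?_⟩
  have : Q s = (Polynomial.evalRingHom s).mapMatrix (Matrix.of F) := by
    ext i j; simp [hF]
  rw [this, ← RingHom.map_det]; rfl

theorem comp_affine (m n d : ℕ) (P P0 : Pol d m n) (s : ℂ) :
    comp m n d (P + s • (P0 - P)) = comp m n d P + s • (comp m n d P0 - comp m n d P) := by
  refine Prod.ext ?_ ?_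
  · ext i j
    simp only [comp, compA, Prod.fst_add, Prod.smul_fst, Prod.fst_sub, Matrix.add_apply,
      Matrix.smul_apply, Matrix.sub_apply, Pi.add_apply, Pi.smul_apply, Pi.sub_apply]
    split_ifs <;> simp
  · ext i j
    simp only [comp, compB, Prod.snd_add, Prod.smul_snd, Prod.snd_sub, Matrix.add_apply,
      Matrix.smul_apply, Matrix.sub_apply, Pi.add_apply, Pi.smul_apply, Pi.sub_apply]
    split_ifs <;> simp

theorem dense_of (m n d : ℕ) (G : Pencil (m + n*(d-1)) (n*d))
    (htan : Function.Surjective (tangentMap G)) (P0 : Pol d m n)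
    (Q0 : Matrix (Fin (m + n*(d-1))) (Fin (m + n*(d-1))) ℂ)
    (R0 : Matrix (Fin (n*d)) (Fin (n*d)) ℂ) (hQ0 : IsUnit Q0) (hR0 : IsUnit R0)
    (h1 : (comp m n d P0).1 * R0 = Q0 * G.1) (h2 : (comp m n d P0).2 * R0 = Q0 * G.2) :
    closure {P : Pol d m n | StrictEquiv (comp m n d P) G} = Set.univ := by
  rw [Set.eq_univ_iff_forall]
  intro P
  let Ψ0 := interMap (comp m n d P) G
  let Ψ1 := interMap (comp m n d P0 - comp m n d P) 0
  have hΨ : ∀ s : ℂ, Ψ0 + s • Ψ1 = interMap (comp m n d (P + s • (P0 - P))) G := by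
    intro s
    rw [comp_affine]
    refine LinearMap.ext fun X => Prod.ext ?_ ?_
    · simp [Ψ0, Ψ1, interMap, Matrix.add_mul, Matrix.sub_mul]
      abel
    · simp [Ψ0, Ψ1, interMap, Matrix.add_mul, Matrix.sub_mul]
      abel
  have hΨ1 : Ψ0 + Ψ1 = interMap (comp m n d P0) G := by
    have := hΨ 1
    simpa using this
  have hQd : IsUnit Q0.det := (Matrix.isUnit_iff_isUnit_det _).1 hQ0
  have hsurj : Function.Surjective (Ψ0 + Ψ1) := by
    rw [hΨ1]
    rintro ⟨E, F⟩
    obtain ⟨⟨X, Y⟩, hXY⟩ := htan (Q0⁻¹ * E, Q0⁻¹ * F)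
    simp only [tangentMap, LinearMap.coe_mk, AddHom.coe_mk, Prod.mk.injEq] at hXY
    refine ⟨(-(Q0 * X), -(R0 * Y)), ?_⟩
    simp only [interMap, LinearMap.coe_mk, AddHom.coe_mk, Prod.mk.injEq, Matrix.mul_neg,
      Matrix.neg_mul, ← Matrix.mul_assoc, h1, h2]
    have e1 := congrArg (fun Z => Q0 * Z) hXY.1
    have e2 := congrArg (fun Z => Q0 * Z) hXY.2
    simp only [Matrix.mul_sub, ← Matrix.mul_assoc, Matrix.mul_nonsing_inv _ hQd,
      Matrix.one_mul] at e1 e2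
    constructor
    · rw [← e1]; abel
    · rw [← e2]; abel
  obtain ⟨x, hx1, hx, hxp⟩ := ext_ker Ψ0 Ψ1 hsurj (Q0, R0) (by
    rw [hΨ1]; simp [interMap, h1, h2])
  obtain ⟨f, hf⟩ := det_poly (fun s => (x s).1) (fun i j =>
    hxp (Matrix.entryLinearMap ℂ ℂ i j ∘ₗ LinearMap.fst ℂ _ _))
  obtain ⟨g, hg⟩ := det_poly (fun s => (x s).2) (fun i j =>
    hxp (Matrix.entryLinearMap ℂ ℂ i j ∘ₗ LinearMap.snd ℂ _ _))
  have hf0 : f ≠ 0 := by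
    rintro rfl
    have := hf 1
    simp only [hx1, Polynomial.eval_zero] at this
    rw [this] at hQd
    simp at hQd
  have hg0 : g ≠ 0 := by
    rintro rfl
    have := hg 1
    have hRd : IsUnit R0.det := (Matrix.isUnit_iff_isUnit_det _).1 hR0
    simp only [hx1, Polynomial.eval_zero] at this
    rw [this] at hRd
    simp at hRd
  have hfin : Set.Finite {s : ℂ | (f * g).IsRoot s} :=
    Polynomial.finite_setOfPred_isRoot (mul_ne_zero hf0 hg0)
  have hdense : Dense ({s : ℂ | (f * g).IsRoot s}ᶜ) := Set.Countable.dense_compl ℂ (Set.Finite.countable hfin)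
  have hcont : Continuous (fun s : ℂ => P + s • (P0 - P)) := by fun_prop
  have h0 : (0 : ℂ) ∈ closure ({s : ℂ | (f * g).IsRoot s}ᶜ) := hdense 0
  have := map_mem_closure hcont h0 (t := {P : Pol d m n | StrictEquiv (comp m n d P) G}) ?_
  · simpa using this
  · intro s hs
    simp only [Set.mem_compl_iff, Set.mem_ofPred_eq, Polynomial.IsRoot, Polynomial.eval_mul,
      mul_eq_zero, not_or] at hs
    have hk := hx s
    rw [hΨ s] at hk
    simp only [interMap, LinearMap.coe_mk, AddHom.coe_mk, Prod.mk_eq_zero, sub_eq_zero] at hk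
    have hu1 : IsUnit (x s).1.det := by
      rw [show (x s).1.det = f.eval s from hf s]; exact isUnit_iff_ne_zero.2 hs.1
    have hu2 : IsUnit (x s).2.det := by
      rw [show (x s).2.det = g.eval s from hg s]; exact isUnit_iff_ne_zero.2 hs.2
    refine ⟨(x s).1, (x s).2, (Matrix.isUnit_iff_isUnit_det _).2 hu1,
      (Matrix.isUnit_iff_isUnit_det _).2 hu2, ?_, ?_⟩
    · rw [Matrix.mul_assoc, hk.1, ← Matrix.mul_assoc, Matrix.nonsing_inv_mul _ hu1, Matrix.one_mul]
    · rw [Matrix.mul_assoc, hk.2, ← Matrix.mul_assoc, Matrix.nonsing_inv_mul _ hu1, Matrix.one_mul]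

theorem exists_blk (g : ℕ → ℕ) (h0 : g 0 = 0) (k u : ℕ) (hu : u < g k) :
    ∃ b, b < k ∧ g b ≤ u ∧ u < g (b + 1) := by
  induction k with
  | zero => omega
  | succ k ih =>
    by_cases h : u < g k
    · obtain ⟨b, hb, h1, h2⟩ := ih h
      exact ⟨b, by omega, h1, h2⟩
    · exact ⟨k, by omega, by omega, hu⟩

theorem off_succ (f : ℕ → ℕ) (b : ℕ) : off f (b + 1) = off f b + f b :=
  Finset.sum_range_succ _ _

theorem off_mono (f : ℕ → ℕ) {b c : ℕ} (h : b ≤ c) : off f b ≤ off f c := by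
  induction c, h using Nat.le_induction with
  | base => exact le_rfl
  | succ c _ ih => rw [off_succ]; omega

/-- The block structure of `G_ℓp`. -/
theorem glp_struct (m n d : ℕ) (hnm : n < m) :
    ∃ (f blk : ℕ → ℕ), (∀ b b', f b ≤ f b' + 1) ∧ off f (m - n) = n * d ∧
      (∀ Y < n * d, blk Y < m - n ∧ off f (blk Y) ≤ Y ∧ Y < off f (blk Y) + f (blk Y)) ∧
      (∀ x Y, (Glp m n d).1 x Y = if (x : ℕ) = (Y : ℕ) + blk Y then 1 else 0) ∧
      (∀ x Y, (Glp m n d).2 x Y = if (x : ℕ) = (Y : ℕ) + blk Y + 1 then 1 else 0) := by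
  obtain ⟨k, rfl⟩ : ∃ k, m = n + k := ⟨m - n, by omega⟩
  have hk : 0 < k := by omega
  let t := n * d % k
  let β := n * d / k
  have htk : t < k := Nat.mod_lt _ hk
  let f : ℕ → ℕ := fun i => if i < t then β + 1 else β
  have hγ : secSize 0 0 t (0+1) (0+1) (β + 1) β = f := by
    funext i; simp [secSize, f]
  have hρ : secSize 0 0 t 0 0 (β + 1 + 1) (β + 1) = fun i => f i + 1 := by
    funext i; simp only [secSize, f]; split_ifs <;> first | rfl | omega
  have hoρ : ∀ b, off (fun i => f i + 1) b = off f b + b := by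
    intro b
    simp [off, Finset.sum_add_distrib]
  have hof : off f k = n * d := by
    have h1 : off f k = k * β + t := by
      have h2 : ∀ j, off f j = j * β + min j t := by
        intro j
        induction j with
        | zero => simp [off]
        | succ j ih =>
          rw [off_succ, ih]
          simp only [f]
          split_ifs with h
          · rw [min_eq_left (by omega), min_eq_left (by omega)]; ring
          · rw [min_eq_right (by omega), min_eq_right (by omega)]; ring
      rw [h2, min_eq_right htk.le]
    rw [h1]; exact Nat.div_add_mod _ _
  have hex : ∀ Y, ∃ b, Y < n * d → (b < k ∧ off f b ≤ Y ∧ Y < off f b + f b) := by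
    intro Y
    by_cases hY : Y < n * d
    · obtain ⟨b, hb⟩ := exists_blk (off f) (by simp [off]) k Y (by omega)
      rw [off_succ] at hb
      exact ⟨b, fun _ => hb⟩
    · exact ⟨0, fun h => absurd h hY⟩
  choose blk hblk using hex
  have hdsum : ∀ (ent : ℕ → ℕ → ℕ → ℂ) (c : ℕ) (_ : c ≤ 1)
      (_ : ∀ b i j, ent b i j = if i = j + c then 1 else 0)
      (x : Fin (n + k + n*(d-1))) (Y : Fin (n * d)),
      dsum k (fun i => f i + 1) f ent (n + k + n*(d-1)) (n*d) x Y
        = if (x : ℕ) = (Y : ℕ) + blk Y + c then 1 else 0 := by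
    intro ent c hc hent x Y
    obtain ⟨hb1, hb2, hb3⟩ := hblk Y Y.2
    unfold dsum
    rw [Finset.sum_eq_single (blk Y)]
    · rw [hent, hoρ, ← ite_and]
      refine if_congr ?_ rfl rfl
      simp only []
      omega
    · intro b _ hne
      rw [if_neg]
      rintro ⟨_, _, h3, h4⟩
      rcases lt_or_gt_of_ne hne with h | h
      · have := off_mono f (show b + 1 ≤ blk Y from h)
        rw [off_succ] at this
        omega
      · have := off_mono f (show blk Y + 1 ≤ b from h)
        rw [off_succ] at this
        omega
    · intro h
      exact absurd (Finset.mem_range.2 hb1) h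
  have hN : 0 + 0 + t + (k - t) = k := by omega
  refine ⟨f, blk, ?_, ?_, ?_, ?_, ?_⟩
  · intro b b'
    simp only [f]
    split_ifs <;> omega
  · rw [Nat.add_sub_cancel_left]; exact hof
  · rw [Nat.add_sub_cancel_left]; exact hblk
  · intro x Y
    simp only [Glp, genPencil, Nat.add_sub_cancel_left]
    change dsum (0 + 0 + t + (k - t)) (secSize 0 0 t 0 0 (β + 1 + 1) (β + 1))
      (secSize 0 0 t (0+1) (0+1) (β + 1) β) _ _ _ x Y = _
    rw [hN, hγ, hρ]
    exact hdsum _ 0 (by omega) (fun b i j => rfl) x Y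
  · intro x Y
    simp only [Glp, genPencil, Nat.add_sub_cancel_left]
    change dsum (0 + 0 + t + (k - t)) (secSize 0 0 t 0 0 (β + 1 + 1) (β + 1))
      (secSize 0 0 t (0+1) (0+1) (β + 1) β) _ _ _ x Y = _
    rw [hN, hγ, hρ]
    exact hdsum _ 1 (by omega) (fun b i j => by simp) x Y

theorem tan_surj (p q k : ℕ) (hp : p = q + k) (f blk : ℕ → ℕ) (hf : ∀ b b', f b ≤ f b' + 1)
    (hq : off f k = q)
    (hblk : ∀ Y < q, blk Y < k ∧ off f (blk Y) ≤ Y ∧ Y < off f (blk Y) + f (blk Y))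
    (G : Pencil p q)
    (hG1 : ∀ x Y, G.1 x Y = if (x : ℕ) = (Y : ℕ) + blk Y then 1 else 0)
    (hG2 : ∀ x Y, G.2 x Y = if (x : ℕ) = (Y : ℕ) + blk Y + 1 then 1 else 0) :
    Function.Surjective (tangentMap G) := by
  rw [← LinearMap.range_eq_top]
  by_contra hne
  obtain ⟨φ, hφ0, hφ⟩ := Submodule.exists_le_ker_of_lt_top _ (lt_top_iff_ne_top.2 hne)
  have hφ' : ∀ (X : Matrix (Fin p) (Fin p) ℂ) (Y : Matrix (Fin q) (Fin q) ℂ), φ (X * G.1 - G.1 * Y, X * G.2 - G.2 * Y) = 0 := fun X Y =>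
    hφ ⟨(X, Y), rfl⟩
  have hbu : ∀ b Y, off f b ≤ Y → Y < off f b + f b → Y < q → blk Y = b := by
    intro b Y h3 h4 hY
    obtain ⟨_, h1, h2⟩ := hblk Y hY
    by_contra hne
    rcases lt_or_gt_of_ne hne with h | h
    · have := off_mono f (show blk Y + 1 ≤ b from h)
      rw [off_succ] at this
      omega
    · have := off_mono f (show b + 1 ≤ blk Y from h)
      rw [off_succ] at this
      omega
  let U : ℕ → ℕ → ℂ := fun Y x => if h : x < p ∧ Y < q then
    φ (Matrix.single ⟨x, h.1⟩ ⟨Y, h.2⟩ 1, 0) else 0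
  let V : ℕ → ℕ → ℂ := fun Y x => if h : x < p ∧ Y < q then
    φ (0, Matrix.single ⟨x, h.1⟩ ⟨Y, h.2⟩ 1) else 0
  have hU : ∀ (Y : Fin q) (x : Fin p), U Y x = φ (Matrix.single x Y 1, 0) := by
    intro Y x; simp [U]
  have hV : ∀ (Y : Fin q) (x : Fin p), V Y x = φ (0, Matrix.single x Y 1) := by
    intro Y x; simp [V]
  have hsplit : ∀ E F, φ (E, F) = φ (E, 0) + φ (0, F) := by
    intro E F; rw [← map_add]; simp
  -- strict monotonicity-type facts
  have hamono : ∀ Y Y', Y < Y' → Y' < q → Y + blk Y < Y' + blk Y' := by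
    intro Y Y' h h'
    obtain ⟨_, h1, h2⟩ := hblk Y (by omega)
    obtain ⟨_, h3, h4⟩ := hblk Y' h'
    have : blk Y ≤ blk Y' := by
      by_contra hc
      have := off_mono f (show blk Y' + 1 ≤ blk Y by omega)
      rw [off_succ] at this
      omega
    omega
  have hainj : ∀ Y Y', Y < q → Y' < q → Y + blk Y = Y' + blk Y' → Y = Y' := by
    intro Y Y' h h' he
    rcases lt_trichotomy Y Y' with h1 | h1 | h1
    · have := hamono _ _ h1 h'; omega
    · exact h1
    · have := hamono _ _ h1 h; omega
  have e2 : ∀ Y Y', Y < q → Y' < q → U Y' (Y + blk Y) + V Y' (Y + blk Y + 1) = 0 := by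
    intro Y Y' hY hY'
    have hb := (hblk Y hY).1
    have := hφ' 0 (Matrix.single (⟨Y, hY⟩ : Fin q) (⟨Y', hY'⟩ : Fin q) (-1 : ℂ))
    have k1 : (0 : Matrix (Fin p) (Fin p) ℂ) * G.1 - G.1 * Matrix.single (⟨Y, hY⟩ : Fin q) (⟨Y', hY'⟩ : Fin q) (-1 : ℂ)
        = Matrix.single (⟨Y + blk Y, by omega⟩ : Fin p) (⟨Y', hY'⟩ : Fin q) (1 : ℂ) := by
      ext i j
      by_cases hj : j = ⟨Y', hY'⟩
      · subst hj
        simp [hG1, Matrix.single_apply, Fin.ext_iff, eq_comm]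
      · simp [Matrix.single_apply, Matrix.mul_single_apply_of_ne, hj, Ne.symm hj, eq_comm]
    have k2 : (0 : Matrix (Fin p) (Fin p) ℂ) * G.2 - G.2 * Matrix.single (⟨Y, hY⟩ : Fin q) (⟨Y', hY'⟩ : Fin q) (-1 : ℂ)
        = Matrix.single (⟨Y + blk Y + 1, by omega⟩ : Fin p) (⟨Y', hY'⟩ : Fin q) (1 : ℂ) := by
      ext i j
      by_cases hj : j = ⟨Y', hY'⟩
      · subst hj
        simp [hG2, Matrix.single_apply, Fin.ext_iff, eq_comm]
      · simp [Matrix.single_apply, Matrix.mul_single_apply_of_ne, hj, Ne.symm hj, eq_comm]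
    rw [k1, k2, hsplit, ← hU, ← hV] at this
    exact this
  have A1 : ∀ (u x : Fin p) (Y : Fin q), (x : ℕ) = Y + blk Y →
      Matrix.single u x (1 : ℂ) * G.1 = Matrix.single u Y 1 := by
    intro u x Y hx
    ext i j
    by_cases hi : i = u
    · subst hi
      simp only [Matrix.single_mul_apply_same, hG1, Matrix.single_apply, one_mul, true_and]
      refine if_congr ?_ rfl rfl
      rw [hx, Fin.ext_iff]
      exact ⟨fun h => hainj _ _ Y.2 j.2 h, fun h => by rw [h]⟩
    · simp [Matrix.single_apply, hi, Ne.symm hi]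
  have A2 : ∀ (u x : Fin p) (Y : Fin q), (x : ℕ) = Y + blk Y + 1 →
      Matrix.single u x (1 : ℂ) * G.2 = Matrix.single u Y 1 := by
    intro u x Y hx
    ext i j
    by_cases hi : i = u
    · subst hi
      simp only [Matrix.single_mul_apply_same, hG2, Matrix.single_apply, one_mul, true_and]
      refine if_congr ?_ rfl rfl
      rw [hx, Fin.ext_iff]
      exact ⟨fun h => hainj _ _ Y.2 j.2 (by omega), fun h => by rw [h]⟩
    · simp [Matrix.single_apply, hi, Ne.symm hi]
  have A3 : ∀ (u x : Fin p), (∀ Y < q, (x : ℕ) ≠ Y + blk Y) →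
      Matrix.single u x (1 : ℂ) * G.1 = 0 := by
    intro u x hx
    ext i j
    by_cases hi : i = u
    · subst hi
      simp [hG1, hx j j.2]
    · simp [hi]
  have A4 : ∀ (u x : Fin p), (∀ Y < q, (x : ℕ) ≠ Y + blk Y + 1) →
      Matrix.single u x (1 : ℂ) * G.2 = 0 := by
    intro u x hx
    ext i j
    by_cases hi : i = u
    · subst hi
      simp [hG2, hx j j.2]
    · simp [hi]
  have hoq : ∀ b, b < k → off f b + f b ≤ q := by
    intro b hb
    have := off_mono f (show b + 1 ≤ k from hb)
    rw [off_succ] at this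
    omega
  -- relations in block coordinates
  have r1 : ∀ b, b < k → ∀ i, i + 1 < f b → ∀ u, u < p →
      U (off f b + (i + 1)) u + V (off f b + i) u = 0 := by
    intro b hb i hi u hu
    have := hoq b hb
    have b1 := hbu b (off f b + (i + 1)) (by omega) (by omega) (by omega)
    have b2 := hbu b (off f b + i) (by omega) (by omega) (by omega)
    have h := hφ' (Matrix.single ⟨u, hu⟩ ⟨off f b + (i + 1) + b, by omega⟩ 1) 0
    rw [A1 _ _ ⟨off f b + (i + 1), by omega⟩ (by simp [b1]),
      A2 _ _ ⟨off f b + i, by omega⟩ (by simp [b2]; omega), Matrix.mul_zero, Matrix.mul_zero,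
      sub_zero, sub_zero, hsplit, ← hU, ← hV] at h
    exact h
  have r2 : ∀ b, b < k → 0 < f b → ∀ u, u < p → U (off f b) u = 0 := by
    intro b hb hi u hu
    have := hoq b hb
    have b1 := hbu b (off f b) (by omega) (by omega) (by omega)
    have h := hφ' (Matrix.single ⟨u, hu⟩ ⟨off f b + b, by omega⟩ 1) 0
    rw [A1 _ _ ⟨off f b, by omega⟩ (by simp [b1]), A4 _ _ ?_, Matrix.mul_zero, Matrix.mul_zero,
      sub_zero, sub_zero, ← hU] at h
    · exact h
    · intro Y hY he
      simp only at he
      obtain ⟨_, h1, h2⟩ := hblk Y hY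
      rcases lt_or_ge (blk Y) b with hc | hc
      · have := off_mono f (show blk Y + 1 ≤ b from hc)
        rw [off_succ] at this
        omega
      · have := off_mono f hc
        omega
  have r3 : ∀ b, b < k → ∀ i, i + 1 = f b → ∀ u, u < p → V (off f b + i) u = 0 := by
    intro b hb i hi u hu
    have := hoq b hb
    have b1 := hbu b (off f b + i) (by omega) (by omega) (by omega)
    have h := hφ' (Matrix.single ⟨u, hu⟩ ⟨off f b + i + b + 1, by omega⟩ 1) 0
    rw [A2 _ _ ⟨off f b + i, by omega⟩ (by simp [b1]), A3 _ _ ?_, Matrix.mul_zero,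
      Matrix.mul_zero, sub_zero, sub_zero, ← hV] at h
    · exact h
    · intro Y hY he
      simp only at he
      obtain ⟨_, h1, h2⟩ := hblk Y hY
      rcases lt_or_ge b (blk Y) with hc | hc
      · have := off_mono f (show b + 1 ≤ blk Y from hc)
        rw [off_succ] at this
        omega
      · have := off_mono f (show blk Y + 1 ≤ b + 1 by omega)
        rw [off_succ, off_succ] at this
        omega
  have e2' : ∀ b', b' < k → ∀ j, j < f b' → ∀ Y, Y < q →
      U Y (off f b' + b' + j) + V Y (off f b' + b' + (j + 1)) = 0 := by
    intro b' hb' j hj Y hY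
    have := hoq b' hb'
    have b1 := hbu b' (off f b' + j) (by omega) (by omega) (by omega)
    have h := e2 (off f b' + j) Y (by omega) hY
    rw [b1] at h
    convert h using 3 <;> omega
  have hp' : ∀ b', b' < k → ∀ j, j ≤ f b' → off f b' + b' + j < p := by
    intro b' hb' j hj
    have := hoq b' hb'
    omega
  have c1 : ∀ b, b < k → ∀ b', b' < k → ∀ i j, i < j → i < f b → j ≤ f b' →
      V (off f b + i) (off f b' + b' + j) = 0 := by
    intro b hb b' hb' i
    have := hoq b hb
    induction i with
    | zero =>
      intro j hj hi hj'
      obtain ⟨j, rfl⟩ : ∃ j0, j = j0 + 1 := ⟨j - 1, by omega⟩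
      have h := e2' b' hb' j (by omega) (off f b) (by omega)
      rw [r2 b hb hi _ (hp' b' hb' _ (by omega)), zero_add] at h
      exact h
    | succ i ih =>
      intro j hj hi hj'
      obtain ⟨j, rfl⟩ : ∃ j0, j = j0 + 1 := ⟨j - 1, by omega⟩
      have h := e2' b' hb' j (by omega) (off f b + (i + 1)) (by omega)
      have h2 := r1 b hb i hi _ (hp' b' hb' j (by omega))
      rw [ih j (by omega) (by omega) (by omega), add_zero] at h2
      rw [h2, zero_add] at h
      exact h
  have c2 : ∀ b, b < k → ∀ b', b' < k → ∀ r i j, r + i + 1 = f b → j ≤ i → j ≤ f b' →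
      V (off f b + i) (off f b' + b' + j) = 0 := by
    intro b hb b' hb' r
    have := hoq b hb
    have hff := hf b b'
    induction r with
    | zero =>
      intro i j hr hj hj'
      exact r3 b hb i (by omega) _ (hp' b' hb' j hj')
    | succ r ih =>
      intro i j hr hj hj'
      have h := e2' b' hb' j (by omega) (off f b + (i + 1)) (by omega)
      have h2 := r1 b hb i (by omega) _ (hp' b' hb' j (by omega))
      rw [ih (i + 1) (j + 1) (by omega) (by omega) (by omega), add_zero] at h
      rw [h, zero_add] at h2
      exact h2
  have hV0 : ∀ Y u, Y < q → u < p → V Y u = 0 := by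
    intro Y u hY hu
    obtain ⟨hb, h1, h2⟩ := hblk Y hY
    obtain ⟨b', hb', h3, h4⟩ := exists_blk (fun b => off f b + b) (by simp [off]) k u (by
      change u < off f k + k; omega)
    simp only [off_succ] at h3 h4
    obtain ⟨i, hi⟩ : ∃ i, Y = off f (blk Y) + i := ⟨Y - off f (blk Y), by omega⟩
    obtain ⟨j, hj⟩ : ∃ j, u = off f b' + b' + j := ⟨u - (off f b' + b'), by omega⟩
    rw [hi, hj]
    rcases lt_or_ge i j with h | h
    · exact c1 _ hb _ hb' i j h (by omega) (by omega)
    · exact c2 _ hb _ hb' (f (blk Y) - 1 - i) i j (by omega) h (by omega)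
  have hU0 : ∀ Y u, Y < q → u < p → U Y u = 0 := by
    intro Y u hY hu
    obtain ⟨hb, h1, h2⟩ := hblk Y hY
    obtain ⟨i, hi⟩ : ∃ i, Y = off f (blk Y) + i := ⟨Y - off f (blk Y), by omega⟩
    rcases i with _ | i
    · rw [hi]
      exact r2 _ hb (by omega) u hu
    · have h := r1 _ hb i (by omega) u hu
      rw [hV0 _ u (by omega) hu, add_zero, ← hi] at h
      exact h
  apply hφ0
  have z1 : φ ∘ₗ LinearMap.inl ℂ _ _ = 0 := by
    refine Matrix.ext_linearMap _ fun i j => LinearMap.ext_ring ?_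
    have := hU0 j i j.2 i.2
    rw [hU] at this
    simpa using this
  have z2 : φ ∘ₗ LinearMap.inr ℂ _ _ = 0 := by
    refine Matrix.ext_linearMap _ fun i j => LinearMap.ext_ring ?_
    have := hV0 j i j.2 i.2
    rw [hV] at this
    simpa using this
  refine LinearMap.prod_ext ?_ ?_
  · rw [z1]; rfl
  · rw [z2]; rfl

theorem exists_perm (n d : ℕ) (hn : 1 ≤ n) : ∃ σ : Fin (n*d) ≃ Fin (n*d),
    ∀ y y' : Fin (n*d), (y' : ℕ) = y + n → (σ y' : ℕ) = σ y + 1 := by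
  refine ⟨(finCongr (Nat.mul_comm n d)).trans (finProdFinEquiv.symm.trans
    ((Equiv.prodComm _ _).trans finProdFinEquiv)), ?_⟩
  intro y y' h
  simp only [Equiv.trans_apply, finProdFinEquiv, Equiv.coe_fn_mk, Equiv.coe_fn_symm_mk,
    Equiv.prodComm_apply, Prod.swap, Fin.divNat, Fin.modNat, finCongr_apply, Fin.val_cast]
  rw [h, Nat.add_div_right _ (by omega), Nat.add_mod_right]
  omega

theorem exists_P0 (m n d : ℕ) (hn : 1 ≤ n) (hd : 1 ≤ d)
    (a b : Fin (n*d) → Fin (m + n*(d-1))) (ha : StrictMono a) (hb : ∀ Y, (b Y : ℕ) = a Y + 1)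
    (G : Pencil (m + n*(d-1)) (n*d))
    (hG1 : ∀ x Y, G.1 x Y = if x = a Y then 1 else 0)
    (hG2 : ∀ x Y, G.2 x Y = if x = b Y then 1 else 0) :
    ∃ (P0 : Pol d m n) (Q0 : Matrix (Fin (m + n*(d-1))) (Fin (m + n*(d-1))) ℂ)
      (R0 : Matrix (Fin (n*d)) (Fin (n*d)) ℂ), IsUnit Q0 ∧ IsUnit R0 ∧
      (comp m n d P0).1 * R0 = Q0 * G.1 ∧ (comp m n d P0).2 * R0 = Q0 * G.2 := by
  obtain ⟨σ, hσ⟩ := exists_perm n d hn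
  have hnd : n * d = n * (d - 1) + n := by
    obtain ⟨e, rfl⟩ : ∃ e, d = e + 1 := ⟨d - 1, by omega⟩
    simp [Nat.mul_add]
  have hainj : Function.Injective a := ha.injective
  have hbinj : Function.Injective b := by
    intro Y Y' h
    apply hainj
    have := congrArg Fin.val h
    rw [hb, hb] at this
    exact Fin.ext (by omega)
  let lo : Fin (n*(d-1)) → Fin (n*d) := fun l => ⟨l, by omega⟩
  let hi : Fin (n*(d-1)) → Fin (n*d) := fun l => ⟨l + n, by omega⟩
  have hlohi : ∀ l, (σ (hi l) : ℕ) = σ (lo l) + 1 := fun l => hσ _ _ rfl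
  let g : Fin (n*(d-1)) → Fin (m + n*(d-1)) := fun l => a (σ (hi l))
  let h : Fin (n*(d-1)) → Fin (m + n*(d-1)) := fun l => b (σ (lo l))
  have hg : Function.Injective g := by
    intro l l' hl
    have := σ.injective (hainj hl)
    simp only [hi, Fin.mk.injEq] at this
    exact Fin.ext (by omega)
  -- consequences of strict monotonicity
  have hkey : ∀ Y0 Y1 : Fin (n*d), (Y1 : ℕ) = Y0 + 1 → b Y0 ≠ a Y1 →
      (∀ Y, b Y0 ≠ a Y) ∧ (∀ Y, a Y1 ≠ b Y) := by
    intro Y0 Y1 h01 hne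
    have hne' : (a Y0 : ℕ) + 1 ≠ a Y1 := by
      intro hc; exact hne (Fin.ext (by rw [hb]; exact hc))
    have hlt : (a Y0 : ℕ) < a Y1 := ha (Fin.lt_def.2 (by omega))
    constructor
    · intro Y hc
      have hc' := congrArg Fin.val hc
      rw [hb] at hc'
      rcases le_or_gt Y Y0 with h1 | h1
      · have : (a Y : ℕ) ≤ a Y0 := ha.monotone h1
        omega
      · have : (a Y1 : ℕ) ≤ a Y := ha.monotone (Fin.le_def.2 (by have := Fin.lt_def.1 h1; omega))
        omega
    · intro Y hc
      have hc' := congrArg Fin.val hc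
      rw [hb] at hc'
      rcases le_or_gt Y1 Y with h1 | h1
      · have : (a Y1 : ℕ) ≤ a Y := ha.monotone h1
        omega
      · have : (a Y : ℕ) ≤ a Y0 := ha.monotone (Fin.le_def.2 (by have := Fin.lt_def.1 h1; omega))
        omega
  have hS : Fintype.card {x : Fin (m + n*(d-1)) // x ∉ Set.range g} = m := by
    have h1 := Fintype.card_subtype_compl (fun x : Fin (m + n*(d-1)) => x ∈ Set.range g)
    have h2 : Fintype.card {x : Fin (m + n*(d-1)) // x ∈ Set.range g} = n * (d-1) := by
      have := Set.card_range_of_injective hg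
      rw [Fintype.card_fin] at this
      convert this
    rw [h1, h2, Fintype.card_fin]
    omega
  let e : Fin m ≃ {x : Fin (m + n*(d-1)) // x ∉ Set.range g} :=
    (Fintype.equivFinOfCardEq hS).symm
  let sg : Fin (n*d) → ℂ := fun y => (-1) ^ ((y : ℕ) / n)
  have hsg : ∀ y, sg y * sg y = 1 := by
    intro y
    simp only [sg]
    rw [← mul_pow]; simp
  have hsg0 : ∀ y, sg y ≠ 0 := fun y h0 => by
    have := hsg y
    rw [h0] at this; simp at this
  have hsgn : ∀ l, sg (hi l) = - sg (lo l) := by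
    intro l
    simp only [sg, hi, lo]
    rw [Nat.add_div_right _ (by omega), pow_succ]
    ring
  let R0 : Matrix (Fin (n*d)) (Fin (n*d)) ℂ := fun y Y => if σ y = Y then sg y else 0
  let Q0 : Matrix (Fin (m + n*(d-1))) (Fin (m + n*(d-1))) ℂ := fun i x =>
    if hi' : (i : ℕ) < m then (if x = (e ⟨i, hi'⟩ : Fin _) then 1 else 0)
    else sg (hi ⟨i - m, by omega⟩) * ((if x = g ⟨i - m, by omega⟩ then 1 else 0) +
      (if h ⟨i - m, by omega⟩ ≠ g ⟨i - m, by omega⟩ then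
        (if x = h ⟨i - m, by omega⟩ then 1 else 0) else 0))
  have hQtop : ∀ (i : Fin (m + n*(d-1))) (hi' : (i : ℕ) < m) (v : Fin (m + n*(d-1)) → ℂ),
      ∑ x, Q0 i x * v x = v (e ⟨i, hi'⟩) := by
    intro i hi' v
    simp only [Q0, dif_pos hi']
    simp
  have hQbot : ∀ (i : Fin (m + n*(d-1))) (l : Fin (n*(d-1))) (_ : (i : ℕ) = m + l)
      (v : Fin (m + n*(d-1)) → ℂ),
      ∑ x, Q0 i x * v x = sg (hi l) * (v (g l) + if h l ≠ g l then v (h l) else 0) := by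
    intro i l hl v
    have hi' : ¬ (i : ℕ) < m := by omega
    have hl' : (⟨i - m, by omega⟩ : Fin (n*(d-1))) = l := Fin.ext (by simp; omega)
    simp only [Q0, dif_neg hi', hl']
    simp only [mul_assoc, ← Finset.mul_sum, add_mul, Finset.sum_add_distrib]
    congr 2
    · simp
    · split_ifs <;> simp
  have hRmul : ∀ (C : Matrix (Fin (m + n*(d-1))) (Fin (n*d)) ℂ) i y,
      (C * R0) i (σ y) = C i y * sg y := by
    intro C i y
    rw [Matrix.mul_apply, Finset.sum_eq_single y]
    · simp [R0]
    · intro z _ hz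
      simp [R0, σ.injective.eq_iff, hz]
    · simp
  let P0 : Pol d m n := fun κ i c =>
    if hκ : (κ : ℕ) = d then
      sg ⟨c, by have := c.2; nlinarith⟩ *
        (if (e i : Fin _) = a (σ ⟨c, by have := c.2; nlinarith⟩) then 1 else 0)
    else
      sg ⟨(d - 1 - κ) * n + c, by
        have h1 : (d - 1 - (κ : ℕ)) * n ≤ (d - 1) * n := Nat.mul_le_mul_right _ (by omega)
        rw [Nat.mul_comm (d - 1) n] at h1
        omega⟩ *
        (if (e i : Fin _) = b (σ ⟨(d - 1 - κ) * n + c, by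
          have h1 : (d - 1 - (κ : ℕ)) * n ≤ (d - 1) * n := Nat.mul_le_mul_right _ (by omega)
          rw [Nat.mul_comm (d - 1) n] at h1
          omega⟩) then 1 else 0)
  refine ⟨P0, Q0, R0, ?_, ?_, ?_, ?_⟩
  · rw [← Matrix.mulVec_injective_iff_isUnit]
    refine (injective_iff_map_eq_zero (Matrix.mulVecLin Q0)).2 ?_
    intro v hv
    have hv' : ∀ i, ∑ x, Q0 i x * v x = 0 := fun i => congrFun hv i
    have hSv : ∀ x, x ∉ Set.range g → v x = 0 := by
      intro x hx
      have := hv' ⟨e.symm ⟨x, hx⟩, by omega⟩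
      rw [hQtop _ (e.symm ⟨x, hx⟩).2] at this
      simpa using this
    funext x
    by_cases hx : x ∈ Set.range g
    · obtain ⟨l, rfl⟩ := hx
      have := hv' ⟨m + l, by omega⟩
      rw [hQbot _ l rfl, mul_eq_zero, or_iff_right (hsg0 _)] at this
      split_ifs at this with hc
      · rw [hSv (h l), add_zero] at this
        · exact this
        · rintro ⟨l', hl'⟩
          exact (hkey _ _ (hlohi l) hc).1 _ hl'.symm
      · simpa using this
    · exact hSv x hx
  · rw [← Matrix.mulVec_injective_iff_isUnit]
    refine (injective_iff_map_eq_zero (Matrix.mulVecLin R0)).2 ?_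
    intro v hv
    funext Y
    obtain ⟨y, rfl⟩ := σ.surjective Y
    have hy : ∑ x, R0 y x * v x = 0 := congrFun hv y
    simp only [R0, ite_mul, zero_mul, Finset.sum_ite_eq, Finset.mem_univ, if_true,
      mul_eq_zero] at hy
    exact hy.resolve_left (hsg0 _)
  · ext i Y
    obtain ⟨y, rfl⟩ := σ.surjective Y
    rw [hRmul, Matrix.mul_apply]
    simp only [comp, compA]
    by_cases hi' : (i : ℕ) < m
    · rw [hQtop i hi', hG1, dif_pos hi']
      by_cases hy : (y : ℕ) < n
      · rw [dif_pos hy]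
        simp only [P0, Fin.val_last, dif_pos]
        rw [mul_right_comm, hsg, one_mul]
      · rw [dif_neg hy, if_neg, zero_mul]
        intro hc
        refine (e ⟨i, hi'⟩).2 ⟨⟨y - n, by omega⟩, ?_⟩
        rw [hc]
        simp only [g, hi]
        congr 2
        exact Fin.ext (by simp; omega)
    · obtain ⟨l, hl⟩ : ∃ l : Fin (n*(d-1)), (i : ℕ) = m + l := ⟨⟨i - m, by omega⟩, by simp; omega⟩
      rw [hQbot i l hl, dif_neg hi', hG1]
      have h2 : (if h l ≠ g l then G.1 (h l) (σ y) else 0) = 0 := by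
        split_ifs with hc
        · rw [hG1, if_neg ((hkey _ _ (hlohi l) hc).1 _)]
        · rfl
      have h3 : g l = a (σ y) ↔ y = hi l := by
        simp only [g, hainj.eq_iff, σ.injective.eq_iff]
        exact eq_comm
      rw [h2, add_zero]
      by_cases hy : y = hi l
      · rw [if_pos (h3.2 hy), if_pos, hy]
        · ring
        · rw [hy]; simp only [hi]; omega
      · rw [if_neg (fun hc => hy (h3.1 hc)), if_neg]
        · ring
        · rintro ⟨hc1, hc2⟩
          exact hy (Fin.ext (by simp only [hi]; omega))
  · ext i Y
    obtain ⟨y, rfl⟩ := σ.surjective Y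
    rw [hRmul, Matrix.mul_apply]
    simp only [comp, compB]
    by_cases hi' : (i : ℕ) < m
    · rw [hQtop i hi', hG2, dif_pos hi', dif_pos (by omega)]
      have hyd : (y : ℕ) / n < d := Nat.div_lt_of_lt_mul y.2
      have hyy : (d - 1 - (d - 1 - (y : ℕ) / n)) * n + (y : ℕ) % n = y := by
        rw [Nat.sub_sub_self (show (y : ℕ) / n ≤ d - 1 from Nat.le_pred_of_lt hyd)]
        exact Nat.div_add_mod' _ _
      simp only [P0]
      rw [dif_neg (Nat.lt_of_le_of_lt (Nat.sub_le _ _) (by omega : d - 1 < d)).ne]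
      simp only [hyy, Fin.eta]
      rw [mul_right_comm, hsg, one_mul]
    · obtain ⟨l, hl⟩ : ∃ l : Fin (n*(d-1)), (i : ℕ) = m + l := ⟨⟨i - m, by omega⟩, by simp; omega⟩
      rw [hQbot i l hl, dif_neg hi']
      have h3 : h l = b (σ y) ↔ y = lo l := by
        simp only [h, hbinj.eq_iff, σ.injective.eq_iff]
        exact eq_comm
      have h4 : (G.2 (g l) (σ y) + if h l ≠ g l then G.2 (h l) (σ y) else 0) =
          if y = lo l then 1 else 0 := by
        by_cases hc : h l = g l
        · rw [if_neg (not_not.2 hc), ← hc, hG2, add_zero]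
          exact if_congr h3 rfl rfl
        · rw [if_pos hc, hG2, hG2, if_neg ((hkey _ _ (hlohi l) hc).2 _), zero_add]
          exact if_congr h3 rfl rfl
      rw [h4, hsgn]
      by_cases hy : y = lo l
      · rw [if_pos hy, if_pos, hy]
        · ring
        · rw [hy]; simp only [lo]; omega
      · rw [if_neg hy, if_neg]
        · ring
        · intro hc
          exact hy (Fin.ext (by simp only [lo]; omega))

/-- Case `m > n`:  the set of polynomials whose first companion form is
strictly equivalent to `G_ℓp` is dense in `POL_{d,m×n}`. -/
theorem dense_Glp_eigenstructure (m n d : ℕ) (hn : 1 ≤ n) (hnm : n < m) (hd : 1 ≤ d) :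
    closure {P : Pol d m n | StrictEquiv (comp m n d P) (Glp m n d)} = Set.univ := by
  obtain ⟨f, blk, hf, hoff, hblk, hG1, hG2⟩ := glp_struct m n d hnm
  have hnd : n * d = n * (d - 1) + n := by
    obtain ⟨e, rfl⟩ : ∃ e, d = e + 1 := ⟨d - 1, by omega⟩
    simp [Nat.mul_add]
  have hp : m + n * (d - 1) = n * d + (m - n) := by omega
  have htan := tan_surj _ _ (m - n) hp f blk hf hoff hblk _ hG1 hG2
  let a : Fin (n * d) → Fin (m + n * (d - 1)) := fun Y =>
    ⟨Y + blk Y, by have := (hblk Y Y.2).1; omega⟩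
  let b : Fin (n * d) → Fin (m + n * (d - 1)) := fun Y =>
    ⟨Y + blk Y + 1, by have := (hblk Y Y.2).1; omega⟩
  have ha : StrictMono a := by
    intro Y Y' h
    have h : (Y : ℕ) < Y' := h
    obtain ⟨_, h1, h2⟩ := hblk Y Y.2
    obtain ⟨_, h3, h4⟩ := hblk Y' Y'.2
    have : blk Y ≤ blk Y' := by
      by_contra hc
      have := off_mono f (show blk Y' + 1 ≤ blk Y by omega)
      rw [off_succ] at this
      omega
    change (Y : ℕ) + blk Y < Y' + blk Y'
    omega
  obtain ⟨P0, Q0, R0, hQ0, hR0, h1, h2⟩ := exists_P0 m n d hn hd a b ha (fun _ => rfl)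
    (Glp m n d) (fun x Y => by rw [hG1]; simp only [a, Fin.ext_iff])
    (fun x Y => by rw [hG2]; simp only [b, Fin.ext_iff])
  exact dense_of m n d _ htan P0 Q0 R0 hQ0 hR0 h1 h2

end MPoly
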